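/- Let R₀ > 0, let K be a compact subset of the open ball B(0,R₀), U = ℝ² ∖ K, and let T : U → ℂ be an injective holomorphic map with |T(z)| ≥ 1 for all z ∈ U, of the form T(z) = βz + h(z) with β ∈ ℂ ∖ {0} and h : U → ℂ bounded holomorphic; assume |DT(x)| ≤ C₀ for all x ∈ U with |x| ≥ R₀. Let ω : ℝ² → ℝ be smooth with compact support contained in U. Then there exist constants R ≥ R₀ and C > 0 such that |K_T[ω](x)| ≤ C/|x|² for all x with |x| ≥ R, where K_T[ω](x) = (1/(2π)) DT(x)^T ∫ ( (T(x)−T(y))^⊥/|T(x)−T(y)|² − (T(x)−T(y)*)^⊥/|T(x)−T(y)*|² ) ω(y) dy and T(y)* = T(y)/|T(y)|². -/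

import Mathlib

open MeasureTheory Metric Set Filter

noncomputable section

/-- counterclockwise rotation of a vector of ℝ² ≃ ℂ by a right angle: `(x₁,x₂) ↦ (-x₂,x₁)` -/
def perp (v : ℂ) : ℂ := Complex.I * v

/-- the real (euclidean) dot product on ℝ² ≃ ℂ -/
def dotR (a b : ℂ) : ℝ := a.re * b.re + a.im * b.im

/-- the transpose of a real-linear map of ℝ² ≃ ℂ, applied to a vector `w` -/
def transApply (L : ℂ →L[ℝ] ℂ) (w : ℂ) : ℂ :=
  (dotR (L 1) w : ℂ) + (dotR (L Complex.I) w : ℂ) * Complex.I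

/-- the harmonic vector field `H_T(x) = (1/2π) DT(x)^T (T(x)^⊥ / |T(x)|²)` -/
def HT (T : ℂ → ℂ) (x : ℂ) : ℂ :=
  (1 / (2 * Real.pi)) • transApply (fderiv ℝ T x) ((‖T x‖ ^ 2)⁻¹ • perp (T x))

/-- `T(y)* = T(y)/|T(y)|²` -/
def starT (T : ℂ → ℂ) (y : ℂ) : ℂ := (‖T y‖ ^ 2)⁻¹ • T y

/-- the Biot–Savart-type operator
`K_T[ω](x) = (1/2π) DT(x)^T ∫ ((T(x)−T(y))^⊥/|T(x)−T(y)|² − (T(x)−T(y)*)^⊥/|T(x)−T(y)*|²) ω(y) dy` -/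
def KT (T : ℂ → ℂ) (ω : ℂ → ℝ) (x : ℂ) : ℂ :=
  (1 / (2 * Real.pi)) • transApply (fderiv ℝ T x)
    (∫ y : ℂ, ω y • ((‖T x - T y‖ ^ 2)⁻¹ • perp (T x - T y)
      - (‖T x - starT T y‖ ^ 2)⁻¹ • perp (T x - starT T y)))

lemma norm_perp (v : ℂ) : ‖perp v‖ = ‖v‖ := by
  simp [perp]

lemma abs_dotR_le (a b : ℂ) : |dotR a b| ≤ ‖a‖ * ‖b‖ := by
  have h : dotR a b = (a * (starRingEnd ℂ) b).re := by
    simp [dotR]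
  calc |dotR a b| ≤ ‖a * (starRingEnd ℂ) b‖ := h ▸ Complex.abs_re_le_norm _
    _ = ‖a‖ * ‖b‖ := by simp

lemma norm_transApply_le (L : ℂ →L[ℝ] ℂ) (w : ℂ) : ‖transApply L w‖ ≤ 2 * ‖L‖ * ‖w‖ := by
  have h1 : ‖L 1‖ ≤ ‖L‖ := by simpa using L.le_opNorm 1
  have hI : ‖L Complex.I‖ ≤ ‖L‖ := by simpa using L.le_opNorm Complex.I
  calc ‖transApply L w‖ ≤ |dotR (L 1) w| + |dotR (L Complex.I) w| := by
        refine (norm_add_le _ _).trans_eq ?_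
        simp
    _ ≤ ‖L 1‖ * ‖w‖ + ‖L Complex.I‖ * ‖w‖ := add_le_add (abs_dotR_le _ _) (abs_dotR_le _ _)
    _ ≤ ‖L‖ * ‖w‖ + ‖L‖ * ‖w‖ := by gcongr
    _ = 2 * ‖L‖ * ‖w‖ := by ring

/-- The planar Biot–Savart kernel `v^⊥/|v|²` satisfies
`|v^⊥/|v|² − w^⊥/|w|²| = |v − w| / (|v| |w|)`. -/
lemma norm_kernel_sub_kernel {v w : ℂ} (hv : v ≠ 0) (hw : w ≠ 0) :
    ‖(‖v‖ ^ 2)⁻¹ • perp v - (‖w‖ ^ 2)⁻¹ • perp w‖ = ‖v - w‖ / (‖v‖ * ‖w‖) := by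
  have h := dist_div_norm_sq_smul hv hw 1
  rw [dist_eq_norm, dist_eq_norm] at h
  have e : (‖v‖ ^ 2)⁻¹ • perp v - (‖w‖ ^ 2)⁻¹ • perp w =
      perp ((1 / ‖v‖) ^ 2 • v - (1 / ‖w‖) ^ 2 • w) := by
    simp only [perp, Complex.real_smul, one_div, inv_pow]
    ring
  rw [e, norm_perp, h]
  ring

lemma norm_starT_le_one {T : ℂ → ℂ} {y : ℂ} (hy : 1 ≤ ‖T y‖) : ‖starT T y‖ ≤ 1 := by
  have h0 : ‖T y‖ ≠ 0 := by positivity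
  have h : ‖starT T y‖ = ‖T y‖⁻¹ := by
    rw [starT, norm_smul, norm_inv, norm_pow, norm_norm]
    field_simp
  exact h ▸ inv_le_one_of_one_le₀ hy

lemma norm_kernel_sub_kernel_le {a b c : ℂ} {B r : ℝ} (hr : 0 < r) (hb : ‖b‖ ≤ B)
    (hc : ‖c‖ ≤ B) (ha : r + B ≤ ‖a‖) :
    ‖(‖a - b‖ ^ 2)⁻¹ • perp (a - b) - (‖a - c‖ ^ 2)⁻¹ • perp (a - c)‖ ≤ 2 * B / r ^ 2 := by
  have hab : r ≤ ‖a - b‖ := by linarith [norm_sub_norm_le a b]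
  have hac : r ≤ ‖a - c‖ := by linarith [norm_sub_norm_le a c]
  have hbc : ‖a - b - (a - c)‖ ≤ 2 * B := by
    rw [sub_sub_sub_cancel_left]
    linarith [norm_sub_le c b]
  rw [norm_kernel_sub_kernel (norm_pos_iff.1 (hr.trans_le hab)) (norm_pos_iff.1 (hr.trans_le hac)),
    pow_two]
  gcongr
  exact (norm_nonneg _).trans hbc

/-- Decay of the Biot–Savart part: under the stated assumptions on `T` and for
`ω` smooth, compactly supported in `U = ℝ² ∖ K`, there are `R ≥ R₀` and `C > 0` with
`|K_T[ω](x)| ≤ C/|x|²` for all `|x| ≥ R`. -/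
theorem biot_savart_decay
    (R₀ C₀ M : ℝ) (β : ℂ) (K : Set ℂ) (T h : ℂ → ℂ) (ω : ℂ → ℝ)
    (hR₀ : 0 < R₀) (hC₀ : 0 < C₀) (hM : 0 ≤ M) (hβ : β ≠ 0)
    (hK : IsCompact K) (hKb : K ⊆ Metric.ball 0 R₀)
    (hinj : Set.InjOn T Kᶜ)
    (hT : DifferentiableOn ℂ T Kᶜ)
    (hT1 : ∀ z ∈ Kᶜ, 1 ≤ ‖T z‖)
    (hh : DifferentiableOn ℂ h Kᶜ)
    (hhb : ∀ z ∈ Kᶜ, ‖h z‖ ≤ M)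
    (hform : ∀ z ∈ Kᶜ, T z = β * z + h z)
    (hDT : ∀ x ∈ Kᶜ, R₀ ≤ ‖x‖ → ‖fderiv ℝ T x‖ ≤ C₀)
    (hω : ContDiff ℝ (⊤ : ℕ∞) ω) (hωc : HasCompactSupport ω) (hωs : tsupport ω ⊆ Kᶜ) :
    ∃ R C : ℝ, R₀ ≤ R ∧ 0 < C ∧
      ∀ x : ℂ, R ≤ ‖x‖ → ‖KT T ω x‖ ≤ C / ‖x‖ ^ 2 := by
  obtain ⟨B', hB'⟩ := hωc.isCompact.exists_bound_of_continuousOn (hT.continuousOn.mono hωs)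
  set B := max B' 1
  set J := ∫ y, ‖ω y‖
  have hJ : 0 ≤ J := integral_nonneg fun y => norm_nonneg _
  have hB : 1 ≤ B := le_max_right _ _
  have hb : 0 < ‖β‖ := norm_pos_iff.2 hβ
  refine ⟨max R₀ (2 * (M + B) / ‖β‖), 16 * C₀ * B * J / ‖β‖ ^ 2 + 1, le_max_left _ _,
    by positivity, fun x hx => ?_⟩
  have hxR : R₀ ≤ ‖x‖ := (le_max_left _ _).trans hx
  have hx0 : 0 < ‖x‖ := hR₀.trans_le hxR
  have hxK : x ∈ Kᶜ := fun hxK => (mem_ball_zero_iff.1 (hKb hxK)).not_ge hxR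
  have hxM : 2 * (M + B) ≤ ‖x‖ * ‖β‖ := (div_le_iff₀ hb).1 ((le_max_right _ _).trans hx)
  have hTx : ‖β‖ * ‖x‖ / 2 + B ≤ ‖T x‖ := by
    have h1 := norm_sub_le_norm_add (β * x) (h x)
    rw [← hform x hxK, norm_mul] at h1
    linarith [hhb x hxK]
  have hint : ‖∫ y : ℂ, ω y • ((‖T x - T y‖ ^ 2)⁻¹ • perp (T x - T y)
      - (‖T x - starT T y‖ ^ 2)⁻¹ • perp (T x - starT T y))‖
      ≤ J * (2 * B / (‖β‖ * ‖x‖ / 2) ^ 2) := by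
    rw [← integral_mul_const]
    refine norm_integral_le_of_norm_le
      ((hω.continuous.integrable_of_hasCompactSupport hωc).norm.mul_const _)
      (Eventually.of_forall fun y => ?_)
    rw [norm_smul]
    by_cases hy : y ∈ tsupport ω
    · gcongr
      exact norm_kernel_sub_kernel_le (by positivity) ((hB' y hy).trans (le_max_left _ _))
        ((norm_starT_le_one (hT1 y (hωs hy))).trans hB) hTx
    · simp [image_eq_zero_of_notMem_tsupport hy]
  have hpi : ‖(1 / (2 * Real.pi) : ℝ)‖ ≤ 1 := by
    rw [Real.norm_of_nonneg (by positivity), div_le_one (by positivity)]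
    linarith [Real.pi_gt_three]
  calc ‖KT T ω x‖ ≤ 1 * (2 * C₀ * (J * (2 * B / (‖β‖ * ‖x‖ / 2) ^ 2))) := by
        rw [KT, norm_smul]
        gcongr
        refine (norm_transApply_le _ _).trans ?_
        gcongr
        exact hDT x hxK hxR
    _ = (16 * C₀ * B * J / ‖β‖ ^ 2) / ‖x‖ ^ 2 := by
        field_simp
        ring
    _ ≤ (16 * C₀ * B * J / ‖β‖ ^ 2 + 1) / ‖x‖ ^ 2 := by
        gcongr
        linarith

end
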